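/- arXiv:1506.07052 — 2 statements merged into one kernel-verified Lean document; each statement's English description precedes it below -/
import Mathlib

section
/- Let R be a commutative noetherian ring, a ⊊ R a proper ideal, φ : R → S a flat homomorphism of commutative noetherian rings with aS ≠ S, such that the induced map of completions R̂^a → Ŝ^{aS} is an isomorphism. Then an S-module N is aS-adically semidualizing over S if and only if N, viewed as an R-module via φ, is a-adically semidualizing over R. -/
open CategoryTheory

noncomputable section
universe u

/-- `Ext^i_R(M, N)`. -/
abbrev extMod (R : Type u) [CommRing R] (i : ℕ) (M N : Type u) [AddCommGroup M] [Module R M]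
    [AddCommGroup N] [Module R N] : ModuleCat R :=
  ((Ext R (ModuleCat.{u} R) i).obj (Opposite.op (ModuleCat.of R M))).obj (ModuleCat.of R N)

/-- `M` is `a`-torsion: every element is annihilated by a power of `a`. -/
def IsAdicTorsion (R : Type u) [CommRing R] (a : Ideal R) (M : Type u)
    [AddCommGroup M] [Module R M] : Prop :=
  ∀ x : M, ∃ n : ℕ, ∀ r ∈ a ^ n, r • x = 0

/-- `M` is `a`-adically semidualizing over `R`. -/
def IsAdicSemidualizing (R : Type u) [CommRing R] (a : Ideal R) (M : Type u)
    [AddCommGroup M] [Module R M] : Prop :=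
  IsAdicTorsion R a M ∧
  (∀ i : ℕ, Module.Finite R (extMod R i (R ⧸ a) M)) ∧
  (∃ χ : AdicCompletion a R →ₐ[R] Module.End R M, Function.Bijective χ) ∧
  ∀ i : ℕ, 1 ≤ i → Subsingleton (extMod R i M M)

section BaseChange

variable (R S : Type u) [CommRing R] [CommRing S] [Algebra R S] [Module.Flat R S]

def homSource (X : ModuleCat.{u} R) (Y : ModuleCat.{u} S) : ModuleCat.{u} R :=
  (ModuleCat.restrictScalars.{u} (algebraMap R S)).obj
    (ModuleCat.of S ((ModuleCat.extendScalars.{u, u, u} (algebraMap R S)).obj X ⟶ Y))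

def homTarget (X : ModuleCat.{u} R) (Y : ModuleCat.{u} S) : ModuleCat.{u} R :=
  ModuleCat.of R (X ⟶ (ModuleCat.restrictScalars.{u} (algebraMap R S)).obj Y)

def homLinearEquiv (X : ModuleCat.{u} R) (Y : ModuleCat.{u} S) :
    homSource R S X Y ≃ₗ[R] homTarget R S X Y where
  toFun f := (ModuleCat.extendRestrictScalarsAdj (algebraMap R S)).homEquiv X Y f
  invFun g := ((ModuleCat.extendRestrictScalarsAdj (algebraMap R S)).homEquiv X Y).symm g
  left_inv f := Equiv.symm_apply_apply _ _
  right_inv f := Equiv.apply_symm_apply _ _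
  map_add' f g := by
    apply ModuleCat.hom_ext
    apply LinearMap.ext
    intro x
    rfl
  map_smul' r f := by
    apply ModuleCat.hom_ext
    apply LinearMap.ext
    intro x
    rfl

def homIso (X : ModuleCat.{u} R) (Y : ModuleCat.{u} S) :
    homSource R S X Y ≅ homTarget R S X Y :=
  (homLinearEquiv R S X Y).toModuleIso

lemma extIso (i : ℕ) (M : ModuleCat.{u} R) (Y : ModuleCat.{u} S) :
   Nonempty ((ModuleCat.restrictScalars (algebraMap R S)).obj (((Ext S (ModuleCat.{u} S) i).obj (Opposite.op ((ModuleCat.extendScalars (algebraMap R S)).obj M))).obj Y) ≅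
    ((Ext R (ModuleCat.{u} R) i).obj (Opposite.op M)).obj ((ModuleCat.restrictScalars (algebraMap R S)).obj Y)) := by
  let P : ProjectiveResolution M := projectiveResolution M
  let G := ModuleCat.extendScalars.{u,u,u} (algebraMap R S)
  let U := ModuleCat.restrictScalars.{u} (algebraMap R S)
  have : Limits.PreservesFiniteLimits G := ModuleCat.preservesFiniteLimits_extendScalars_of_flat
    (RingHom.flat_algebraMap_iff.mpr inferInstance)
  have : G.IsLeftAdjoint := (ModuleCat.extendRestrictScalarsAdj (algebraMap R S)).isLeftAdjoint
  have : Limits.PreservesFiniteColimits G := inferInstance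
  have : G.Additive := Functor.additive_of_preserves_binary_products G
  have : G.PreservesProjectiveObjects := ⟨fun {X} hX => 
    (ModuleCat.extendRestrictScalarsAdj (algebraMap R S)).map_projective X hX⟩
  have : G.PreservesHomology := inferInstance
  let Q := G.mapProjectiveResolution P
  refine ⟨U.mapIso (Q.isoExt i Y) ≪≫ ?_ ≪≫ (P.isoExt i _).symm⟩
  refine (((Q.complex.linearYonedaObj S Y).sc i).mapHomologyIso U).symm ≪≫ ?_
  change ((U.mapHomologicalComplex _).obj (Q.complex.linearYonedaObj S Y)).homology i ≅ _
  refine (HomologicalComplex.homologyFunctor _ _ i).mapIso (HomologicalComplex.Hom.isoOfComponents (fun j => homIso R S (P.complex.X j) Y) ?_)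
  intro j k h
  apply ModuleCat.hom_ext
  apply LinearMap.ext
  intro (f : G.obj (P.complex.X j) ⟶ Y)
  exact ((ModuleCat.extendRestrictScalarsAdj (algebraMap R S)).homEquiv_naturality_left
    (P.complex.d k j) f).symm

end BaseChange

lemma smul_homology_eq_zero {S : Type u} [CommRing S] {X : ModuleCat.{u} S}
    (P : ProjectiveResolution X) (Y : ModuleCat.{u} S) (c : S) (hc : ∀ x : X, c • x = 0) (n : ℕ)
    (z : (P.complex.linearYonedaObj S Y).homology n) : c • z = 0 := by
  let K := P.complex.linearYonedaObj S Y
  have hπ : (c • 𝟙 P.complex) ≫ P.π = 0 := by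
    ext x
    have h : c • (P.π.f 0).hom x = 0 := hc _
    simp only [HomologicalComplex.comp_f, HomologicalComplex.smul_f_apply, HomologicalComplex.id_f, Linear.smul_comp, Category.id_comp]
    exact h
  let H := ProjectiveResolution.liftHomotopyZero _ hπ
  obtain ⟨y, rfl⟩ := (ModuleCat.epi_iff_surjective (K.homologyπ n)).mp inferInstance z
  have hinj := (ModuleCat.mono_iff_injective (K.iCycles n)).mp inferInstance
  have hcyc : ∀ f : P.complex.X n ⟶ Y, (K.iCycles n).hom y = f → P.complex.d (n+1) n ≫ f = 0 := by
    intro f hf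
    have h := congr($(K.iCycles_d n (n+1)) y)
    have h2 : (K.d n (n+1)).hom ((K.iCycles n).hom y) = 0 := h
    rw [hf] at h2
    exact h2
  have key : ∀ m, ∀ w : K.X m, (K.d m n).hom w = c • (K.iCycles n).hom y →
      c • (K.homologyπ n).hom y = 0 := by
    intro m w hw
    have h1 : (K.toCycles m n).hom w = c • y := by
      apply hinj
      have h := congr($(K.toCycles_i m n) w)
      have h2 : (K.iCycles n).hom ((K.toCycles m n).hom w) = (K.d m n).hom w := h
      erw [h2, hw]
      exact (map_smul (K.iCycles n).hom c y).symm
    have h3 : (K.homologyπ n).hom ((K.toCycles m n).hom w) = 0 := congr($(K.toCycles_comp_homologyπ m n) w)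
    rw [h1, map_smul] at h3
    exact h3
  obtain ⟨f, hf⟩ : ∃ f : P.complex.X n ⟶ Y, (K.iCycles n).hom y = f := ⟨_, rfl⟩
  have hcomm := H.comm n
  rcases n with _ | n
  · apply key 0 0
    rw [map_zero]
    rw [hf]
    have : c • f = 0 := by
      have h := congr($hcomm ≫ f)
      rw [Homotopy.prevD_chainComplex, Homotopy.dNext_zero_chainComplex] at h
      simpa [hcyc f hf] using h
    exact this.symm
  · apply key n (H.hom n (n+1) ≫ f)
    rw [hf]
    have h := congr($hcomm ≫ f)
    rw [Homotopy.prevD_chainComplex, Homotopy.dNext_succ_chainComplex] at h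
    have : P.complex.d (n+1) n ≫ H.hom n (n+1) ≫ f = c • f := by
      simpa [hcyc f hf] using h.symm
    exact this

lemma exists_sub_mem (R S : Type u) [CommRing R] [CommRing S] [IsNoetherianRing R]
    [Algebra R S] (a : Ideal R)
    (e : AdicCompletion a R ≃+* AdicCompletion (a.map (algebraMap R S)) S)
    (he : ∀ r : R, e (algebraMap R (AdicCompletion a R) r) =
        algebraMap S (AdicCompletion (a.map (algebraMap R S)) S) (algebraMap R S r))
    (n : ℕ) (s : S) : ∃ r : R, s - algebraMap R S r ∈ (a ^ n).map (algebraMap R S) := by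
  let x := e.symm (algebraMap S _ s)
  obtain ⟨r, hr⟩ := Ideal.Quotient.mk_surjective (AdicCompletion.evalₐ a n x)
  refine ⟨r, ?_⟩
  have hx : x - algebraMap R _ r ∈ (AdicCompletion.eval a R n).ker := by
    have h0 : AdicCompletion.evalₐ a n (x - algebraMap R _ r) = 0 := by
      rw [map_sub, ← hr, AlgHom.commutes]; simp
    rw [LinearMap.mem_ker, ← AdicCompletion.factor_evalₐ_eq_eval _ _ (by simp), h0, map_zero]
  rw [← AdicCompletion.pow_smul_top_eq_ker_eval (IsNoetherian.noetherian a)] at hx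
  have h2 : ∀ y ∈ (a ^ n • ⊤ : Submodule R (AdicCompletion a R)),
      AdicCompletion.evalₐ (a.map (algebraMap R S)) n (e y) = 0 := by
    intro y hy
    induction hy using Submodule.smul_induction_on' with
    | smul b hb m hm =>
      rw [Algebra.smul_def, map_mul, he, map_mul, AlgHom.commutes]
      have : algebraMap S (S ⧸ (a.map (algebraMap R S)) ^ n) (algebraMap R S b) = 0 := by
        rw [Ideal.Quotient.algebraMap_eq, Ideal.Quotient.eq_zero_iff_mem, ← Ideal.map_pow]
        exact Ideal.mem_map_of_mem _ hb
      rw [this, zero_mul]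
    | add x hx y hy h1 h2 => rw [map_add, map_add, h1, h2, add_zero]
  have h3 := h2 _ hx
  rw [map_sub, he, RingEquiv.apply_symm_apply, ← map_sub, AlgHom.commutes,
    Ideal.Quotient.algebraMap_eq, Ideal.Quotient.eq_zero_iff_mem, ← Ideal.map_pow] at h3
  exact h3

lemma mem_of_algebraMap_mem (R S : Type u) [CommRing R] [CommRing S]
    [Algebra R S] (a : Ideal R)
    (e : AdicCompletion a R ≃+* AdicCompletion (a.map (algebraMap R S)) S)
    (he : ∀ r : R, e (algebraMap R (AdicCompletion a R) r) =
        algebraMap S (AdicCompletion (a.map (algebraMap R S)) S) (algebraMap R S r))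
    (r : R) (hr : algebraMap R S r ∈ a.map (algebraMap R S)) : r ∈ a := by
  have h : ∀ y ∈ a.map (algebraMap R S), AdicCompletion.evalOneₐ a (e.symm (algebraMap S _ y)) = 0 := by
    intro y hy
    induction hy using Submodule.span_induction with
    | mem x hx =>
      obtain ⟨b, hb, rfl⟩ := hx
      rw [← he, RingEquiv.symm_apply_apply, AlgHom.commutes, Ideal.Quotient.algebraMap_eq, Ideal.Quotient.eq_zero_iff_mem]
      exact hb
    | zero => simp
    | add x y _ _ h1 h2 => rw [map_add, map_add, map_add, h1, h2, add_zero]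
    | smul c x _ h => rw [smul_eq_mul, map_mul, map_mul, map_mul, h, mul_zero]
  have h3 := h _ hr
  rwa [← he, RingEquiv.symm_apply_apply, AlgHom.commutes, Ideal.Quotient.algebraMap_eq, Ideal.Quotient.eq_zero_iff_mem] at h3

lemma smul_eq_zero_of_mem_map {R S : Type u} [CommRing R] [CommRing S] [Algebra R S] (I : Ideal R)
    {N : Type u} [AddCommGroup N] [Module S N] [Module R N] [IsScalarTower R S N] (x : N)
    (h : ∀ r ∈ I, r • x = 0) : ∀ s ∈ I.map (algebraMap R S), s • x = 0 := by
  intro s hs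
  induction hs using Submodule.span_induction with
  | mem y hy =>
    obtain ⟨b, hb, rfl⟩ := hy
    rw [algebraMap_smul, h b hb]
  | zero => simp
  | add y z _ _ h1 h2 => rw [add_smul, h1, h2, add_zero]
  | smul c y _ h1 => rw [smul_assoc, h1, smul_zero]

lemma torsion_iff {R S : Type u} [CommRing R] [CommRing S] [Algebra R S] (a : Ideal R)
    {N : Type u} [AddCommGroup N] [Module S N] [Module R N] [IsScalarTower R S N] :
    IsAdicTorsion S (a.map (algebraMap R S)) N ↔ IsAdicTorsion R a N := by
  refine forall_congr' fun x => exists_congr fun n => ?_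
  rw [← Ideal.map_pow]
  refine ⟨fun h r hr => ?_, smul_eq_zero_of_mem_map _ x⟩
  rw [← algebraMap_smul S]
  exact h _ (Ideal.mem_map_of_mem _ hr)

lemma exists_smul_eq {R S : Type u} [CommRing R] [CommRing S] [Algebra R S] (a : Ideal R)
    (hs : ∀ (n : ℕ) (s : S), ∃ r : R, s - algebraMap R S r ∈ (a ^ n).map (algebraMap R S))
    (n : ℕ) (s : S) : ∃ r : R, ∀ {N : Type u} [AddCommGroup N] [Module S N] [Module R N]
      [IsScalarTower R S N] (x : N), (∀ r ∈ a ^ n, r • x = 0) → s • x = r • x := by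
  obtain ⟨r, hr⟩ := hs n s
  refine ⟨r, fun {N} _ _ _ _ x hx => ?_⟩
  have := smul_eq_zero_of_mem_map _ x hx _ hr
  rwa [sub_smul, sub_eq_zero, algebraMap_smul] at this

lemma map_smul_of_torsion {R S : Type u} [CommRing R] [CommRing S] [Algebra R S] (a : Ideal R)
    (hs : ∀ (n : ℕ) (s : S), ∃ r : R, s - algebraMap R S r ∈ (a ^ n).map (algebraMap R S))
    {N : Type u} [AddCommGroup N] [Module S N] [Module R N] [IsScalarTower R S N]
    (hN : IsAdicTorsion R a N) (f : N →ₗ[R] N) (s : S) (x : N) : f (s • x) = s • f x := by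
  obtain ⟨n, hn⟩ := hN x
  obtain ⟨r, hr⟩ := exists_smul_eq a hs n s
  rw [hr x hn, hr (f x) (fun b hb => by rw [← map_smul, hn b hb, map_zero]), map_smul]

/-- endomorphisms over R and S agree -/
def endEquiv {R S : Type u} [CommRing R] [CommRing S] [Algebra R S] (a : Ideal R)
    (hs : ∀ (n : ℕ) (s : S), ∃ r : R, s - algebraMap R S r ∈ (a ^ n).map (algebraMap R S))
    {N : Type u} [AddCommGroup N] [Module S N] [Module R N] [IsScalarTower R S N]
    (hN : IsAdicTorsion R a N) : Module.End S N ≃+* Module.End R N where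
  toFun f := f.restrictScalars R
  invFun f := { f with map_smul' := map_smul_of_torsion a hs hN f }
  left_inv _ := rfl
  right_inv _ := rfl
  map_add' _ _ := rfl
  map_mul' _ _ := rfl

lemma homothety_iff {R S : Type u} [CommRing R] [CommRing S] [Algebra R S] (a : Ideal R)
    (hs : ∀ (n : ℕ) (s : S), ∃ r : R, s - algebraMap R S r ∈ (a ^ n).map (algebraMap R S))
    (e : AdicCompletion a R ≃+* AdicCompletion (a.map (algebraMap R S)) S)
    (he : ∀ r : R, e (algebraMap R (AdicCompletion a R) r) =
        algebraMap S (AdicCompletion (a.map (algebraMap R S)) S) (algebraMap R S r))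
    {N : Type u} [AddCommGroup N] [Module S N] [Module R N] [IsScalarTower R S N]
    (hN : IsAdicTorsion R a N) :
    (∃ χ : AdicCompletion (a.map (algebraMap R S)) S →ₐ[S] Module.End S N, Function.Bijective χ) ↔
    (∃ χ : AdicCompletion a R →ₐ[R] Module.End R N, Function.Bijective χ) := by
  constructor
  · rintro ⟨χ, hχ⟩
    refine ⟨{ ((endEquiv a hs hN).toRingHom.comp (χ.toRingHom.comp e.toRingHom)) with
      commutes' := fun r => ?_ }, (endEquiv a hs hN).bijective.comp (hχ.comp e.bijective)⟩
    change endEquiv a hs hN (χ (e (algebraMap R _ r))) = _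
    rw [he, AlgHom.commutes]
    ext x
    exact algebraMap_smul S r x
  · rintro ⟨χ, hχ⟩
    refine ⟨{ ((endEquiv a hs hN).symm.toRingHom.comp (χ.toRingHom.comp e.symm.toRingHom)) with
      commutes' := fun s => ?_ }, (endEquiv a hs hN).symm.bijective.comp (hχ.comp e.symm.bijective)⟩
    change (endEquiv a hs hN).symm (χ (e.symm (algebraMap S _ s))) = _
    ext x
    change χ (e.symm (algebraMap S _ s)) x = s • x
    obtain ⟨n, hn⟩ := hN x
    obtain ⟨r, hr⟩ := hs n s
    have h0 : ∀ y ∈ (a ^ n).map (algebraMap R S), χ (e.symm (algebraMap S _ y)) x = 0 := by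
      intro y hy
      induction hy using Submodule.span_induction with
      | mem y hy =>
        obtain ⟨b, hb, rfl⟩ := hy
        rw [← he, RingEquiv.symm_apply_apply, AlgHom.commutes]
        exact hn b hb
      | zero => simp
      | add y z _ _ h1 h2 => rw [map_add, map_add, map_add, LinearMap.add_apply, h1, h2, add_zero]
      | smul c y _ h1 => rw [smul_eq_mul, map_mul, map_mul, map_mul, Module.End.mul_apply, h1, map_zero]
    have h1 := h0 _ hr
    have h2 := smul_eq_zero_of_mem_map _ x hn _ hr
    rw [map_sub, ← he, map_sub, RingEquiv.symm_apply_apply, map_sub, AlgHom.commutes, LinearMap.sub_apply, sub_eq_zero] at h1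
    rw [h1]
    rw [sub_smul, sub_eq_zero, algebraMap_smul] at h2
    exact h2.symm

lemma finite_iff {R S : Type u} [CommRing R] [CommRing S] [Algebra R S] (a : Ideal R)
    (hs : ∀ (n : ℕ) (s : S), ∃ r : R, s - algebraMap R S r ∈ (a ^ n).map (algebraMap R S))
    {E : Type u} [AddCommGroup E] [Module S E] [Module R E] [IsScalarTower R S E]
    (hE : ∀ r ∈ a, ∀ x : E, r • x = 0) :
    Module.Finite S E ↔ Module.Finite R E := by
  refine ⟨fun h => ?_, fun h => Module.Finite.of_restrictScalars_finite R S E⟩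
  obtain ⟨t, ht⟩ := h
  refine ⟨t, ?_⟩
  rw [eq_top_iff]
  intro x _
  have hx : x ∈ Submodule.span S (t : Set E) := ht ▸ Submodule.mem_top
  induction hx using Submodule.span_induction with
  | mem x h => exact Submodule.subset_span h
  | zero => exact zero_mem _
  | add x y _ _ h1 h2 => exact add_mem (h1 trivial) (h2 trivial)
  | smul c x _ h =>
    obtain ⟨r, hr⟩ := exists_smul_eq a hs 1 c
    rw [hr x (fun b hb => hE b (by simpa using hb) x)]
    exact Submodule.smul_mem _ _ (h trivial)

lemma isIso_counit {R S : Type u} [CommRing R] [CommRing S] [Algebra R S] (a : Ideal R)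
    (hs : ∀ (n : ℕ) (s : S), ∃ r : R, s - algebraMap R S r ∈ (a ^ n).map (algebraMap R S))
    (T : Type u) [AddCommGroup T] [Module S T]
    (hT : IsAdicTorsion S (a.map (algebraMap R S)) T) :
    IsIso ((ModuleCat.extendRestrictScalarsAdj.{u, u, u} (algebraMap R S)).counit.app
      (ModuleCat.of S T)) := by
  let f := algebraMap R S
  let G := ModuleCat.extendScalars.{u, u, u} f
  let U := ModuleCat.restrictScalars.{u} f
  let Y := ModuleCat.of S T
  let ε := (ModuleCat.extendRestrictScalarsAdj.{u, u, u} f).counit.app Y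
  let W := U.obj Y
  let η : W →ₗ[R] U.obj (G.obj W) :=
    ((ModuleCat.extendRestrictScalarsAdj.{u, u, u} f).unit.app W).hom
  have hεη : ∀ t : W, ε (η t) = t := fun t =>
    congr($((ModuleCat.extendRestrictScalarsAdj.{u, u, u} f).right_triangle_components Y) t)
  -- the S-action on the image of a killed element
  have hkill : ∀ (n : ℕ) (t : W), (∀ r ∈ a ^ n, r • t = 0) → ∀ y ∈ (a ^ n).map f,
      (y • (η t : G.obj W) : G.obj W) = 0 := by
    intro n t ht y hy
    induction hy using Submodule.span_induction with
    | mem y hy =>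
      obtain ⟨b, hb, rfl⟩ := hy
      have h : η (b • t) = b • η t := map_smul _ _ _
      rw [ht b hb, map_zero] at h
      exact h.symm
    | zero => exact zero_smul _ _
    | add y z _ _ h1 h2 =>
      have := add_smul y z (η t : G.obj W)
      rw [this, h1, h2, add_zero]
    | smul c y _ h1 =>
      have := mul_smul c y (η t : G.obj W)
      rw [smul_eq_mul, this, h1, smul_zero]
  have hsurj : ∀ z : G.obj W, ∃ t : W, (η t : G.obj W) = z := by
    intro z
    induction z using TensorProduct.induction_on with
    | zero => exact ⟨0, map_zero _⟩
    | add x y hx hy =>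
      obtain ⟨t, rfl⟩ := hx
      obtain ⟨t2, rfl⟩ := hy
      exact ⟨t + t2, map_add _ _ _⟩
    | tmul s t =>
      change S at s
      obtain ⟨n, hn⟩ := hT (t : T)
      obtain ⟨r, hr⟩ := hs n s
      have hk := hkill n t (fun r hr => hn _ (by rw [← Ideal.map_pow]; exact Ideal.mem_map_of_mem _ hr)) _ hr
      have h2 := sub_smul s (f r) (η t : G.obj W)
      have h3 : η (r • t) = r • η t := map_smul _ _ _
      have h4 : (s • (η t : G.obj W) : G.obj W) = η (r • t) := by
        rw [h3]
        exact sub_eq_zero.mp (h2.symm.trans hk)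
      refine ⟨r • t, ?_⟩
      rw [← h4]
      refine (ModuleCat.ExtendScalars.smul_tmul f s (1 : S) t).trans ?_
      rw [mul_one]
      rfl
  have hbij : Function.Bijective ε := by
    constructor
    · intro x y hxy
      obtain ⟨t, rfl⟩ := hsurj x
      obtain ⟨t2, rfl⟩ := hsurj y
      rw [hεη, hεη] at hxy
      rw [hxy]
    · intro t
      exact ⟨η t, hεη t⟩
  exact (ConcreteCategory.isIso_iff_bijective ε).mpr hbij

/-- `N` over `R` is the restriction of scalars of `N` over `S`. -/
def restrictIso {R S : Type u} [CommRing R] [CommRing S] [Algebra R S]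
    (M T : Type u) [AddCommGroup T] [Module S T] [Module R T] [IsScalarTower R S T]
    [AddCommGroup M] [Module R M] (e : M ≃ₗ[R] T) :
    ModuleCat.of R M ≅ (ModuleCat.restrictScalars.{u} (algebraMap R S)).obj (ModuleCat.of S T) :=
  let W := (ModuleCat.restrictScalars.{u} (algebraMap R S)).obj (ModuleCat.of S T)
  let eW : M ≃ₗ[R] W :=
    { toFun := fun x => (e x : T)
      invFun := fun t => e.symm (t : T)
      left_inv := fun x => e.symm_apply_apply x
      right_inv := fun x => e.apply_symm_apply x
      map_add' := fun x y => map_add e x y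
      map_smul' := fun r x => (map_smul e r x).trans (algebraMap_smul S r (e x)).symm }
  eW.toModuleIso

lemma extModIso {R S : Type u} [CommRing R] [CommRing S] [Algebra R S] [Module.Flat R S]
    (a : Ideal R)
    (hs : ∀ (n : ℕ) (s : S), ∃ r : R, s - algebraMap R S r ∈ (a ^ n).map (algebraMap R S))
    (M T : Type u) [AddCommGroup T] [Module S T] [Module R T] [IsScalarTower R S T]
    [AddCommGroup M] [Module R M] (e : M ≃ₗ[R] T)
    (hT : IsAdicTorsion S (a.map (algebraMap R S)) T)
    (N : Type u) [AddCommGroup N] [Module S N] [Module R N] [IsScalarTower R S N] (i : ℕ) :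
    Nonempty ((ModuleCat.restrictScalars.{u} (algebraMap R S)).obj (extMod S i T N) ≅
      extMod R i M N) := by
  have := isIso_counit a hs T hT
  let c := asIso ((ModuleCat.extendRestrictScalarsAdj.{u, u, u} (algebraMap R S)).counit.app
      (ModuleCat.of S T))
  obtain ⟨φ⟩ := extIso R S i ((ModuleCat.restrictScalars.{u} (algebraMap R S)).obj
    (ModuleCat.of S T)) (ModuleCat.of S N)
  refine ⟨(ModuleCat.restrictScalars.{u} (algebraMap R S)).mapIso
    (((Ext S (ModuleCat.{u} S) i).mapIso c.op).app (ModuleCat.of S N)) ≪≫ φ ≪≫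
    ((Ext R (ModuleCat.{u} R) i).mapIso (restrictIso M T e).op).app _ ≪≫
    ((Ext R (ModuleCat.{u} R) i).obj _).mapIso
      (restrictIso N N (LinearEquiv.refl R N)).symm⟩

lemma finite_extMod_iff {R S : Type u} [CommRing R] [CommRing S] [Algebra R S] [Module.Flat R S]
    (a : Ideal R)
    (hs : ∀ (n : ℕ) (s : S), ∃ r : R, s - algebraMap R S r ∈ (a ^ n).map (algebraMap R S))
    (hi : ∀ r : R, algebraMap R S r ∈ a.map (algebraMap R S) → r ∈ a)
    (N : Type u) [AddCommGroup N] [Module S N] [Module R N] [IsScalarTower R S N] (i : ℕ) :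
    Module.Finite S (extMod S i (S ⧸ a.map (algebraMap R S)) N) ↔
      Module.Finite R (extMod R i (R ⧸ a) N) := by
  let b := a.map (algebraMap R S)
  have hb : ∀ s ∈ b, ∀ x : S ⧸ b, s • x = 0 := by
    intro s hs x
    obtain ⟨y, rfl⟩ := Ideal.Quotient.mk_surjective x
    rw [← Ideal.Quotient.mk_eq_mk, ← Submodule.Quotient.mk_smul, Submodule.Quotient.mk_eq_zero,
      smul_eq_mul]
    exact Ideal.mul_mem_right _ _ hs
  have htor : IsAdicTorsion S b (S ⧸ b) := fun x => ⟨1, fun r hr => hb r (by simpa using hr) x⟩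
  let g : R →ₗ[R] S ⧸ b := Algebra.linearMap R (S ⧸ b)
  have hgv : ∀ r, g r = Ideal.Quotient.mk b (algebraMap R S r) := fun _ => rfl
  have hg : Function.Surjective g := by
    intro x
    obtain ⟨s, rfl⟩ := Ideal.Quotient.mk_surjective x
    obtain ⟨r, hr⟩ := hs 1 s
    refine ⟨r, ?_⟩
    rw [hgv, eq_comm, Ideal.Quotient.eq]
    simpa using hr
  have hk : g.ker = a := by
    ext r
    rw [LinearMap.mem_ker, hgv, Ideal.Quotient.eq_zero_iff_mem]
    exact ⟨hi r, Ideal.mem_map_of_mem _⟩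
  let e : (R ⧸ a) ≃ₗ[R] S ⧸ b :=
    (Submodule.quotEquivOfEq _ _ hk.symm).trans (g.quotKerEquivOfSurjective hg)
  obtain ⟨φ⟩ := extModIso a hs (R ⧸ a) (S ⧸ b) e htor N i
  rw [← Module.Finite.equiv_iff φ.toLinearEquiv]
  letI : Module R (extMod S i (S ⧸ b) N) := Module.compHom _ (algebraMap R S)
  haveI : IsScalarTower R S (extMod S i (S ⧸ b) N) :=
    ⟨fun r s x => by
      rw [Algebra.smul_def, mul_smul]; rfl⟩
  refine finite_iff a hs (E := extMod S i (S ⧸ b) N) ?_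
  intro r hr x
  have hz := smul_homology_eq_zero (projectiveResolution (ModuleCat.of S (S ⧸ b)))
    (ModuleCat.of S N) (algebraMap R S r) (hb _ (Ideal.mem_map_of_mem _ hr)) i
    (((projectiveResolution (ModuleCat.of S (S ⧸ b))).isoExt i (ModuleCat.of S N)).toLinearEquiv x)
  rw [← map_smul] at hz
  exact (LinearEquiv.map_eq_zero_iff _).mp hz

/-- Let `φ : R → S` be a flat homomorphism of commutative noetherian rings with `aS ≠ S` such
that the induced map of completions `R̂^a → Ŝ^{aS}` is an isomorphism.  Then an `S`-module `N`
is `aS`-adically semidualizing over `S` if and only if `N`, viewed as an `R`-module by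
restriction of scalars, is `a`-adically semidualizing over `R`. -/
theorem restrictScalars_isAdicSemidualizing
    (R S : Type u) [CommRing R] [CommRing S] [IsNoetherianRing R] [IsNoetherianRing S]
    [Algebra R S] [Module.Flat R S]
    (a : Ideal R) (ha : a ≠ ⊤) (haS : a.map (algebraMap R S) ≠ ⊤)
    (hcomp : ∃ e : AdicCompletion a R ≃+* AdicCompletion (a.map (algebraMap R S)) S,
      ∀ r : R, e (algebraMap R (AdicCompletion a R) r) =
        algebraMap S (AdicCompletion (a.map (algebraMap R S)) S) (algebraMap R S r))
    (N : Type u) [AddCommGroup N] [Module S N] [Module R N] [IsScalarTower R S N] :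
    IsAdicSemidualizing S (a.map (algebraMap R S)) N ↔ IsAdicSemidualizing R a N := by
  obtain ⟨e, he⟩ := hcomp
  have hs := exists_sub_mem R S a e he
  have hi := mem_of_algebraMap_mem R S a e he
  unfold IsAdicSemidualizing
  rw [torsion_iff a]
  refine and_congr_right fun hN => ?_
  refine and_congr (forall_congr' fun i => finite_extMod_iff a hs hi N i) ?_
  refine and_congr (homothety_iff a hs e he hN) ?_
  refine forall_congr' fun i => imp_congr_right fun _ => ?_
  obtain ⟨φ⟩ := extModIso a hs N N (LinearEquiv.refl R N) ((torsion_iff a).mpr hN) N i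
  exact φ.toLinearEquiv.toEquiv.subsingleton_congr

end
end

section
/- Let (R, m, k) be a local noetherian artinian ring. Then an R-module T is quasi-dualizing over R if and only if T is a semidualizing R-module; in particular E_R(k) is semidualizing and every semidualizing module M satisfies that Hom_R(M, E_R(k)) is semidualizing. -/
open CategoryTheory

noncomputable section
universe u

/-- `T` is quasi-dualizing over a local ring `R`:  `T` is artinian, the homothety map
`R̂ → Hom_R(T,T)` is an isomorphism, and `Ext^i_R(T,T) = 0` for `i ≥ 1`. -/
def IsQuasiDualizing (R : Type u) [CommRing R] [IsLocalRing R] (T : Type u)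
    [AddCommGroup T] [Module R T] : Prop :=
  IsArtinian R T ∧
  (∃ χ : AdicCompletion (IsLocalRing.maximalIdeal R) R →ₐ[R] Module.End R T,
    Function.Bijective χ) ∧
  ∀ i : ℕ, 1 ≤ i → Subsingleton (extMod R i T T)

/-- `M` is a semidualizing `R`-module. -/
def IsSemidualizing (R : Type u) [CommRing R] (M : Type u)
    [AddCommGroup M] [Module R M] : Prop :=
  Module.Finite R M ∧
  Function.Bijective (algebraMap R (Module.End R M)) ∧
  ∀ i : ℕ, 1 ≤ i → Subsingleton (extMod R i M M)

/-- `E` is an injective hull of the residue field `k` of a local ring `R`. -/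
def IsInjectiveHullOfResidueField (R : Type u) [CommRing R] [IsLocalRing R]
    (E : Type u) [AddCommGroup E] [Module R E] : Prop :=
  Module.Injective R E ∧
  ∃ f : IsLocalRing.ResidueField R →ₗ[R] E, Function.Injective f ∧
    ∀ N : Submodule R E, N ≠ ⊥ → N ⊓ LinearMap.range f ≠ ⊥

namespace QD

section ext
variable {R : Type u} [CommRing R]

lemma ext_iff (n : ℕ) (X Y : ModuleCat.{u} R) :
    Subsingleton (((Ext R (ModuleCat.{u} R) (n+1)).obj (Opposite.op X)).obj Y) ↔
      Subsingleton (Abelian.Ext X Y (n+1)) := by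
  let P := projectiveResolution X
  have h1 : Subsingleton (((Ext R (ModuleCat.{u} R) (n+1)).obj (Opposite.op X)).obj Y) ↔
      ∀ f : P.complex.X (n+1) ⟶ Y, P.complex.d (n+2) (n+1) ≫ f = 0 →
        ∃ g : P.complex.X n ⟶ Y, P.complex.d (n+1) n ≫ g = f := by
    rw [← ModuleCat.isZero_iff_subsingleton, (P.isoExt (R := R) (n+1) Y).isZero_iff,
      ← HomologicalComplex.exactAt_iff_isZero_homology,
      HomologicalComplex.exactAt_iff' _ n (n+1) (n+2) (by simp) (by simp),
      ShortComplex.moduleCat_exact_iff]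
    rfl
  rw [h1]
  constructor
  · intro h
    refine ⟨fun a b => ?_⟩
    have key : ∀ a : Abelian.Ext X Y (n+1), a = 0 := by
      intro a
      obtain ⟨f, hf, rfl⟩ := P.extMk_surjective a (n+2) rfl
      rw [P.extMk_eq_zero_iff f (n+2) rfl hf n rfl]
      exact h f hf
    rw [key a, key b]
  · intro h f hf
    exact (P.extMk_eq_zero_iff f (n+2) rfl hf n rfl).1 (Subsingleton.elim _ _)

lemma comp_extClass_aux {S : ShortComplex (ModuleCat.{u} R)} (hS : S.ShortExact)
    {A : ModuleCat.{u} R} (a : A ⟶ S.X₂) :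
    (Abelian.Ext.mk₀ (a ≫ S.g)).comp hS.extClass (zero_add 1) = 0 := by
  rw [← Abelian.Ext.mk₀_comp_mk₀_assoc, hS.comp_extClass, Abelian.Ext.comp_zero]

end ext

section dual
variable {R : Type u} [CommRing R] (E : Type u) [AddCommGroup E] [Module R E]

/-- evaluation into the double dual -/
def ev (M : Type u) [AddCommGroup M] [Module R M] : M →ₗ[R] ((M →ₗ[R] E) →ₗ[R] E) :=
  LinearMap.flip LinearMap.id

/-- the dual of a map -/
def dmap {M N : Type u} [AddCommGroup M] [Module R M] [AddCommGroup N] [Module R N]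
    (f : M →ₗ[R] N) : (N →ₗ[R] E) →ₗ[R] (M →ₗ[R] E) := LinearMap.lcomp R E f

@[simp] lemma dmap_apply {M N : Type u} [AddCommGroup M] [Module R M] [AddCommGroup N]
    [Module R N] (f : M →ₗ[R] N) (φ : N →ₗ[R] E) (x : M) : dmap E f φ x = φ (f x) := rfl

@[simp] lemma ev_apply {M : Type u} [AddCommGroup M] [Module R M] (x : M) (φ : M →ₗ[R] E) :
    ev E M x φ = φ x := rfl

lemma dmap_bijective {M N : Type u} [AddCommGroup M] [Module R M] [AddCommGroup N] [Module R N]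
    (h : Function.Bijective (ev (R := R) E N)) :
    Function.Bijective (fun f : M →ₗ[R] N => dmap E f) := by
  constructor
  · intro f g hfg
    ext x
    apply h.1
    ext φ
    exact LinearMap.congr_fun (LinearMap.congr_fun hfg φ) x
  · intro k
    refine ⟨(LinearEquiv.ofBijective _ h).symm.toLinearMap ∘ₗ k.flip, ?_⟩
    ext φ x
    have := LinearEquiv.apply_symm_apply (LinearEquiv.ofBijective _ h) (k.flip x)
    exact LinearMap.congr_fun this φ

lemma dmap_exact [Module.Injective R E] {A B C : Type u} [AddCommGroup A] [Module R A]
    [AddCommGroup B] [Module R B] [AddCommGroup C] [Module R C]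
    (f : A →ₗ[R] B) (g : B →ₗ[R] C) (hg : Function.Surjective g)
    (h : Function.Exact f g) :
    Function.Exact (dmap E g) (dmap E f) := by
  intro φ
  constructor
  · intro hφ
    have hk : LinearMap.ker g ≤ LinearMap.ker φ := by
      intro x hx
      obtain ⟨a, rfl⟩ := (h x).1 hx
      exact LinearMap.congr_fun hφ a
    refine ⟨(LinearMap.ker g).liftQ φ hk ∘ₗ (g.quotKerEquivOfSurjective hg).symm.toLinearMap, ?_⟩
    ext x
    simp only [dmap_apply, LinearMap.comp_apply, LinearEquiv.coe_coe]
    have : (g.quotKerEquivOfSurjective hg).symm (g x) = Submodule.Quotient.mk x := by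
      rw [LinearEquiv.symm_apply_eq]; rfl
    rw [this]; rfl
  · rintro ⟨ψ, rfl⟩
    ext x
    simp [h.apply_apply_eq_zero]

lemma dmap_surjective [Module.Injective R E] {A B : Type u} [AddCommGroup A] [Module R A]
    [AddCommGroup B] [Module R B]
    (f : A →ₗ[R] B) (hf : Function.Injective f) : Function.Surjective (dmap E f) := by
  intro φ
  obtain ⟨ψ, h⟩ := Module.Injective.extension_property R _ _ _ f hf φ
  exact ⟨ψ, h⟩

lemma dmap_injective {A B : Type u} [AddCommGroup A] [Module R A]
    [AddCommGroup B] [Module R B]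
    (f : A →ₗ[R] B) (hf : Function.Surjective f) : Function.Injective (dmap E f) := by
  intro φ ψ h
  ext x
  obtain ⟨a, rfl⟩ := hf x
  exact LinearMap.congr_fun h a

lemma dual_free_injective [Module.Injective R E] (F : Type u) [AddCommGroup F] [Module R F]
    [Module.Free R F] : Module.Injective R (F →ₗ[R] E) := by
  have b := Module.Free.chooseBasis R F
  have e := b.constr R (M' := E)
  have : Module.Injective R (Module.Free.ChooseBasisIndex R F → E) := inferInstance
  rw [← Module.Baer.iff_injective] at this ⊢
  exact this.of_equiv e

/-- dual short complex -/
def dualSC (S : ShortComplex (ModuleCat.{u} R)) : ShortComplex (ModuleCat.{u} R) :=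
  ShortComplex.mk (X₁ := ModuleCat.of R (S.X₃ →ₗ[R] E)) (X₂ := ModuleCat.of R (S.X₂ →ₗ[R] E))
    (X₃ := ModuleCat.of R (S.X₁ →ₗ[R] E))
    (ModuleCat.ofHom (dmap E S.g.hom)) (ModuleCat.ofHom (dmap E S.f.hom)) (by
      ext φ x
      have : S.g (S.f x) = 0 := by
        rw [← ConcreteCategory.comp_apply, S.zero]; rfl
      change φ (S.g (S.f x)) = 0
      rw [this, map_zero])

lemma dualSC_exact [Module.Injective R E] {S : ShortComplex (ModuleCat.{u} R)}
    (hS : S.ShortExact) : (dualSC E S).ShortExact where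
  exact := by
    rw [ShortComplex.ShortExact.moduleCat_exact_iff_function_exact]
    exact dmap_exact E _ _ hS.moduleCat_surjective_g
      ((ShortComplex.ShortExact.moduleCat_exact_iff_function_exact S).1 hS.exact)
  mono_f := by
    rw [ModuleCat.mono_iff_injective]
    exact dmap_injective E _ hS.moduleCat_surjective_g
  epi_g := by
    rw [ModuleCat.epi_iff_surjective]
    exact dmap_surjective E _ hS.moduleCat_injective_f

lemma ext_dual [Module.Injective R E] (N : ModuleCat.{u} R)
    (hN : Function.Bijective (ev (R := R) E N)) (n : ℕ) : ∀ X : ModuleCat.{u} R,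
    Subsingleton (Abelian.Ext X N (n+1)) →
    Subsingleton (Abelian.Ext (ModuleCat.of R (N →ₗ[R] E)) (ModuleCat.of R (X →ₗ[R] E)) (n+1)) := by
  induction n with
  | zero =>
    intro X hX
    have hS := X.shortExact_projectiveShortComplex
    have hT := dualSC_exact E hS
    have : Injective (dualSC E X.projectiveShortComplex).X₂ :=
      have := dual_free_injective (R := R) E X.projectiveShortComplex.X₂
      Module.injective_object_of_injective_module R _
    refine subsingleton_of_forall_eq 0 fun y => ?_
    obtain ⟨x₃, rfl⟩ := postcomp_extClass_surjective_of_projective_X₂ hT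
      (ModuleCat.of R (N →ₗ[R] E)) 0 y
    obtain ⟨k, rfl⟩ := (Abelian.Ext.mk₀_bijective _ _).2 x₃
    obtain ⟨f, hf⟩ := (dmap_bijective E hN).2 k.hom
    obtain ⟨x₂, hx₂⟩ := Abelian.Ext.contravariant_sequence_exact₁ hS N
      (Abelian.Ext.mk₀ (ModuleCat.ofHom f)) (n₁ := 1) rfl (hX.elim _ _)
    obtain ⟨g, rfl⟩ := (Abelian.Ext.mk₀_bijective _ _).2 x₂
    rw [Abelian.Ext.mk₀_comp_mk₀] at hx₂
    have hx := (Abelian.Ext.mk₀_bijective _ _).1 hx₂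
    have hk : k = ModuleCat.ofHom (dmap E g.hom) ≫ (dualSC E X.projectiveShortComplex).g := by
      refine ModuleCat.hom_ext (LinearMap.ext fun φ => LinearMap.ext fun x => ?_)
      have h1 : (show X.projectiveShortComplex.X₁ →ₗ[R] E from k.hom φ) x = φ (f x) := by rw [← hf]; rfl
      have h2 : f x = g (X.projectiveShortComplex.f x) := by
        have := congrArg (fun t => t.hom x) hx
        exact this.symm
      exact h1.trans (congrArg φ h2)
    subst hk
    exact comp_extClass_aux hT _
  | succ n ih =>
    intro X hX
    have hS := X.shortExact_projectiveShortComplex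
    have hT := dualSC_exact E hS
    have : Injective (dualSC E X.projectiveShortComplex).X₂ :=
      have := dual_free_injective (R := R) E X.projectiveShortComplex.X₂
      Module.injective_object_of_injective_module R _
    have : Projective X.projectiveShortComplex.X₂ :=
      (IsProjective.iff_projective _).1 inferInstance
    have hK : Subsingleton (Abelian.Ext X.projectiveShortComplex.X₁ N (n+1)) := by
      refine subsingleton_of_forall_eq 0 fun y => ?_
      obtain ⟨x₂, rfl⟩ := Abelian.Ext.contravariant_sequence_exact₁ hS N y (n₁ := n+1+1)
        (add_comm _ _) (hX.elim _ _)
      rw [Abelian.Ext.eq_zero_of_projective x₂, Abelian.Ext.comp_zero]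
    have hK' := ih _ hK
    refine subsingleton_of_forall_eq 0 fun y => ?_
    obtain ⟨x₃, rfl⟩ := postcomp_extClass_surjective_of_projective_X₂ hT
      (ModuleCat.of R (N →ₗ[R] E)) (n+1) y
    have : x₃ = 0 := hK'.elim _ _
    rw [this, map_zero]
    rfl

end dual

section matlis
variable {R : Type u} [CommRing R] [IsLocalRing R]
  (E : Type u) [AddCommGroup E] [Module R E]

lemma ev_injective (hE : IsInjectiveHullOfResidueField R E)
    (M : Type u) [AddCommGroup M] [Module R M] : Function.Injective (ev (R := R) E M) := by
  obtain ⟨hinj, f, hf, -⟩ := hE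
  rw [injective_iff_map_eq_zero]
  intro x hx
  by_contra hx0
  let t := LinearMap.toSpanSingleton R M x
  have hk : LinearMap.ker t ≤ LinearMap.ker (IsLocalRing.maximalIdeal R).mkQ := by
    rw [Submodule.ker_mkQ]
    apply IsLocalRing.le_maximalIdeal
    intro h
    apply hx0
    have : (1:R) ∈ LinearMap.ker t := h ▸ Submodule.mem_top
    simpa [t] using this
  let q : R ⧸ LinearMap.ker t →ₗ[R] M := (LinearMap.ker t).liftQ t le_rfl
  have hq : Function.Injective q := by
    rw [← LinearMap.ker_eq_bot]; exact Submodule.ker_liftQ_eq_bot _ _ _ le_rfl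
  let p : R ⧸ LinearMap.ker t →ₗ[R] IsLocalRing.ResidueField R :=
    (LinearMap.ker t).liftQ (IsLocalRing.maximalIdeal R).mkQ hk
  obtain ⟨φ, hφ⟩ := Module.Injective.extension_property R _ _ _ q hq (f ∘ₗ p)
  have h1 : φ x = 0 := LinearMap.congr_fun hx φ
  have h2 := LinearMap.congr_fun hφ (Submodule.Quotient.mk 1)
  have h3 : q (Submodule.Quotient.mk 1) = x := one_smul R x
  rw [LinearMap.comp_apply, h3, h1, LinearMap.comp_apply] at h2
  have h4 : p (Submodule.Quotient.mk 1) = 0 := hf (by rw [← h2, map_zero])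
  have h5 : p (Submodule.Quotient.mk 1) = (1 : IsLocalRing.ResidueField R) := rfl
  exact one_ne_zero (h5.symm.trans h4)

lemma length_dual_residue (hE : IsInjectiveHullOfResidueField R E) :
    Module.length R (IsLocalRing.ResidueField R →ₗ[R] E) = 1 := by
  obtain ⟨hinj, f, hf, hess⟩ := hE
  have hsimp : IsSimpleModule R (IsLocalRing.ResidueField R) := by
    have : IsSimpleModule R (R ⧸ IsLocalRing.maximalIdeal R) := by
      rw [isSimpleModule_iff_isCoatom]
      exact (IsLocalRing.maximalIdeal.isMaximal R).out
    exact this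
  rw [← Module.length_eq_one R (IsLocalRing.ResidueField R)]
  symm
  have hsur : Function.Surjective (algebraMap R (IsLocalRing.ResidueField R)) :=
    IsLocalRing.residue_surjective
  let θ : (IsLocalRing.ResidueField R →ₗ[R] E) →ₗ[R] E := LinearMap.applyₗ 1
  have hθ : Function.Injective θ := by
    intro g h hgh
    ext x
    obtain ⟨r, rfl⟩ := hsur x
    have hgh : g 1 = h 1 := hgh
    rw [Algebra.algebraMap_eq_smul_one, map_smul, map_smul, hgh]
  have hr : LinearMap.range θ = LinearMap.range f := by
    apply le_antisymm
    · rintro _ ⟨g, rfl⟩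
      change g 1 ∈ _
      by_cases h0 : g = 0
      · simp [h0]
      have hg : Function.Injective g := (LinearMap.injective_or_eq_zero g).resolve_right h0
      have hb : LinearMap.range g ≠ ⊥ := by rwa [Ne, LinearMap.range_eq_bot]
      obtain ⟨y, hy, hy0⟩ := Submodule.exists_mem_ne_zero_of_ne_bot (hess _ hb)
      obtain ⟨⟨a, rfl⟩, hy2⟩ := hy
      have ha : a ≠ 0 := by rintro rfl; simp at hy0
      obtain ⟨r, hr⟩ := hsur a⁻¹
      have : g 1 = r • g a := by
        rw [← map_smul, Algebra.smul_def, hr, inv_mul_cancel₀ ha]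
      rw [this]
      exact Submodule.smul_mem _ _ hy2
    · rintro _ ⟨a, rfl⟩
      obtain ⟨r, rfl⟩ := hsur a
      refine ⟨r • f, ?_⟩
      change r • f 1 = _
      rw [Algebra.algebraMap_eq_smul_one, map_smul]
  exact ((LinearEquiv.ofInjective f hf).trans ((LinearEquiv.ofEq _ _ hr.symm).trans
    (LinearEquiv.ofInjective θ hθ).symm)).length_eq

variable [IsArtinianRing R]

lemma length_dual (hE : IsInjectiveHullOfResidueField R E)
    (M : Type u) [AddCommGroup M] [Module R M] [hM : Module.Finite R M] :
    Module.length R (M →ₗ[R] E) = Module.length R M := by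
  have := hE.1
  induction hM using IsNoetherianRing.induction_on_isQuotientEquivQuotientPrime R with
  | subsingleton N => 
    rw [Module.length_eq_zero, Module.length_eq_zero]
  | quotient N p e =>
    have hp : p.1 = IsLocalRing.maximalIdeal R := IsLocalRing.eq_maximalIdeal inferInstance
    let e' : N ≃ₗ[R] IsLocalRing.ResidueField R := e.trans (Submodule.quotEquivOfEq _ _ hp)
    have hsimp : IsSimpleModule R (R ⧸ IsLocalRing.maximalIdeal R) := by
      rw [isSimpleModule_iff_isCoatom]
      exact (IsLocalRing.maximalIdeal.isMaximal R).out
    have h1 : Module.length R (R ⧸ IsLocalRing.maximalIdeal R) = 1 := Module.length_eq_one _ _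
    rw [e'.length_eq, (LinearEquiv.congrLeft E R e').length_eq, length_dual_residue E hE]
    exact h1.symm
  | exact N₁ N₂ N₃ f g hf hg hfg h₁ h₃ =>
    rw [Module.length_eq_add_of_exact f g hf hg hfg,
      Module.length_eq_add_of_exact (dmap E g) (dmap E f) (dmap_injective E g hg)
        (dmap_surjective E f hf) (dmap_exact E f g hg hfg), h₁, h₃, add_comm]

lemma finite_dual (hE : IsInjectiveHullOfResidueField R E)
    (M : Type u) [AddCommGroup M] [Module R M] [hM : Module.Finite R M] :
    Module.Finite R (M →ₗ[R] E) := by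
  have h := length_dual E hE M
  have : IsFiniteLength R (M →ₗ[R] E) := by
    rw [← Module.length_ne_top_iff, h]
    exact Module.length_ne_top
  exact ((IsArtinianRing.tfae R (M →ₗ[R] E)).out 3 0).1 this

lemma ev_bijective (hE : IsInjectiveHullOfResidueField R E)
    (M : Type u) [AddCommGroup M] [Module R M] [hM : Module.Finite R M] :
    Function.Bijective (ev (R := R) E M) := by
  refine ⟨ev_injective E hE M, ?_⟩
  have := finite_dual E hE M
  have := finite_dual E hE (M →ₗ[R] E)
  have h : Module.length R ((M →ₗ[R] E) →ₗ[R] E) = Module.length R M := by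
    rw [length_dual E hE, length_dual E hE]
  by_contra hs
  rw [← LinearMap.range_eq_top] at hs
  have h1 := Submodule.length_lt hs
  rw [← (LinearEquiv.ofInjective _ (ev_injective E hE M)).length_eq, h] at h1
  exact lt_irrefl _ h1

lemma semidualizing_dual (hE : IsInjectiveHullOfResidueField R E)
    (M : Type u) [AddCommGroup M] [Module R M] (hM : IsSemidualizing R M) :
    IsSemidualizing R (M →ₗ[R] E) := by
  obtain ⟨hfin, hend, hext⟩ := hM
  have := hE.1
  have hev := ev_bijective E hE M
  refine ⟨finite_dual E hE M, ?_, ?_⟩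
  · have h := (dmap_bijective (M := M) E hev).comp hend
    have heq : (fun f : M →ₗ[R] M => dmap E f) ∘ (algebraMap R (Module.End R M)) =
        algebraMap R (Module.End R (M →ₗ[R] E)) := by
      funext r
      ext φ x
      simp [Module.algebraMap_end_apply]
    rw [← heq]
    exact h
  · rintro (_ | n) hn
    · omega
    · rw [ext_iff]
      exact ext_dual E (ModuleCat.of R M) hev n _ ((ext_iff _ _ _).1 (hext (n+1) hn))

lemma semidualizing_congr {M N : Type u} [AddCommGroup M] [Module R M] [AddCommGroup N]
    [Module R N] (e : M ≃ₗ[R] N) (hM : IsSemidualizing R M) : IsSemidualizing R N := by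
  obtain ⟨hfin, hend, hext⟩ := hM
  refine ⟨Module.Finite.equiv e, ?_, ?_⟩
  · have h := e.conj.bijective.comp hend
    have heq : e.conj ∘ (algebraMap R (Module.End R M)) = algebraMap R (Module.End R N) := by
      funext r
      ext x
      simp [Module.algebraMap_end_apply, LinearEquiv.conj_apply]
    rw [← heq]
    exact h
  · intro i hi
    have := hext i hi
    let F := Ext R (ModuleCat.{u} R) i
    let a : extMod R i M M ≅ extMod R i N N :=
      (F.mapIso e.toModuleIso.symm.op).app _ ≪≫ (F.obj _).mapIso e.toModuleIso
    exact a.toLinearEquiv.symm.toEquiv.subsingleton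

lemma semidualizing_self : IsSemidualizing R R := by
  refine ⟨inferInstance, ?_, ?_⟩
  · constructor
    · intro a b h
      simpa using LinearMap.congr_fun h 1
    · intro f
      refine ⟨f 1, ?_⟩
      ext
      simp [Module.algebraMap_end_apply]
  · rintro (_ | n) hn
    · omega
    · have : Projective (ModuleCat.of R R) :=
        (IsProjective.iff_projective _).1 inferInstance
      exact ModuleCat.subsingleton_of_isZero (isZero_Ext_succ_of_projective _ _ _)

lemma quasi_iff (T : Type u) [AddCommGroup T] [Module R T] :
    IsQuasiDualizing R T ↔ IsSemidualizing R T := by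
  have hfa : IsArtinian R T ↔ Module.Finite R T := (IsArtinianRing.tfae R T).out 2 0
  have hc : Function.Bijective
      (algebraMap R (AdicCompletion (IsLocalRing.maximalIdeal R) R)) :=
    AdicCompletion.of_bijective (IsLocalRing.maximalIdeal R) R
  have hx : (∃ χ : AdicCompletion (IsLocalRing.maximalIdeal R) R →ₐ[R] Module.End R T,
      Function.Bijective χ) ↔ Function.Bijective (algebraMap R (Module.End R T)) := by
    constructor
    · rintro ⟨χ, hχ⟩
      have := hχ.comp hc
      rwa [← AlgHom.coe_toRingHom, ← RingHom.coe_comp, AlgHom.comp_algebraMap] at this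
    · intro h
      let e := AlgEquiv.ofBijective (Algebra.ofId R (AdicCompletion (IsLocalRing.maximalIdeal R) R)) hc
      refine ⟨(Algebra.ofId R (Module.End R T)).comp e.symm.toAlgHom, ?_⟩
      exact Function.Bijective.comp (g := Algebra.ofId R (Module.End R T)) h e.symm.bijective
  unfold IsQuasiDualizing IsSemidualizing
  rw [hfa, hx]

end matlis

end QD

/-- Over an artinian local noetherian ring `(R, m, k)`:  a module `T` is quasi-dualizing if and
only if it is semidualizing; moreover `E_R(k)` is semidualizing, and for every semidualizing
module `M` the module `Hom_R(M, E_R(k))` is semidualizing. -/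
theorem quasiDualizing_iff_semidualizing_of_artinian
    (R : Type u) [CommRing R] [IsLocalRing R] [IsArtinianRing R]
    (E : Type u) [AddCommGroup E] [Module R E]
    (hE : IsInjectiveHullOfResidueField R E) :
    (∀ (T : Type u) [AddCommGroup T] [Module R T],
      IsQuasiDualizing R T ↔ IsSemidualizing R T) ∧
    IsSemidualizing R E ∧
    (∀ (M : Type u) [AddCommGroup M] [Module R M],
      IsSemidualizing R M → IsSemidualizing R (M →ₗ[R] E)) := by
  refine ⟨fun T _ _ => QD.quasi_iff T, ?_, fun M _ _ hM => QD.semidualizing_dual E hE M hM⟩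
  exact QD.semidualizing_congr (LinearMap.ringLmapEquivSelf R R E)
    (QD.semidualizing_dual E hE R QD.semidualizing_self)

end
end
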